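/- Any bounded measurable solution u : ℝ → ℝ of the homogeneous equation u(x) = ∫_{-∞}^∞ K(x-y) u(y) dy for x > 0, with u(x) = 0 for x < 0, vanishes identically: u = 0 almost everywhere. -/

import Mathlib

open MeasureTheory Real Set Filter

noncomputable def K (x : ℝ) : ℝ := (1/2) * ∫ t in Set.Ioi |x|, Real.exp (-t) / t

lemma K_nonneg (z : ℝ) : 0 ≤ K z := by
  refine mul_nonneg (by norm_num) (setIntegral_nonneg measurableSet_Ioi fun t ht => ?_)
  exact div_nonneg (exp_pos _).le ((abs_nonneg z).trans (le_of_lt ht))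

lemma ofReal_K_le (z : ℝ) :
    ENNReal.ofReal (K z) ≤ ∫⁻ t in Ioi (0 : ℝ),
      if |z| < t then ENNReal.ofReal (exp (-t) / (2 * t)) else 0 := by
  have hK : K z = ∫ t in Ioi |z|, exp (-t) / (2 * t) := by
    rw [K, ← integral_const_mul]
    congr 1
    ext t
    rw [div_mul_eq_div_div_swap]
    ring
  have hnn : 0 ≤ᵐ[volume.restrict (Ioi |z|)] fun t => exp (-t) / (2 * t) := by
    filter_upwards [ae_restrict_mem measurableSet_Ioi] with t ht
    have : 0 < t := (abs_nonneg z).trans_lt ht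
    simp only [Pi.zero_apply]
    positivity
  rw [hK, integral_eq_lintegral_of_nonneg_ae hnn
    (by measurability : Measurable fun t : ℝ => exp (-t) / (2 * t)).aestronglyMeasurable]
  refine ENNReal.ofReal_toReal_le.trans ?_
  rw [← lintegral_indicator measurableSet_Ioi, ← lintegral_indicator measurableSet_Ioi]
  refine lintegral_mono fun t => ?_
  by_cases h : |z| < t
  · have : 0 < t := (abs_nonneg z).trans_lt h
    simp [indicator, h, this]
  · simp [indicator, h]

lemma lintegral_Ioc_affine {a b : ℝ} (ha : 0 ≤ a) (hab : a ≤ b) :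
    ∫⁻ y in Ioc a b, ENNReal.ofReal (2 + y) =
      ENNReal.ofReal (2 * (b - a) + (b ^ 2 - a ^ 2) / 2) := by
  have hi : IntervalIntegrable (fun y : ℝ => 2 + y) volume a b :=
    (by fun_prop : Continuous fun y : ℝ => 2 + y).intervalIntegrable _ _
  rw [← ofReal_integral_eq_lintegral_ofReal]
  · rw [← intervalIntegral.integral_of_le hab,
      intervalIntegral.integral_add (by simp) (by simp)]
    simp
    ring_nf
  · exact (intervalIntegrable_iff_integrableOn_Ioc_of_le hab).1 hi
  · filter_upwards [ae_restrict_mem measurableSet_Ioc] with y hy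
    simp only [Pi.zero_apply]
    linarith [hy.1]

/-- The integral over `t > x` of the majorant of the kernel average of `2 + y`. -/
lemma lintegral_Ioi_majorant {x : ℝ} (hx : 0 < x)
    (hnn : ∀ t ∈ Ioi x, 0 ≤ exp (-t) * (2 + x - (2 * (t - x) - (t - x) ^ 2 / 2) / (2 * (4 + x)))) :
    ∫⁻ t in Ioi x, ENNReal.ofReal
        (exp (-t) * (2 + x - (2 * (t - x) - (t - x) ^ 2 / 2) / (2 * (4 + x)))) =
      ENNReal.ofReal (exp (-x) * (2 + x) - exp (-x) / (2 * (4 + x))) := by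
  set H : ℝ → ℝ := fun t =>
    exp (-t) * (-(2 + x) + (1 + (t - x) - (t - x) ^ 2 / 2) / (2 * (4 + x))) with hH
  have hd : ∀ t : ℝ, HasDerivAt H
      (exp (-t) * (2 + x - (2 * (t - x) - (t - x) ^ 2 / 2) / (2 * (4 + x)))) t := by
    intro t
    have h1 : HasDerivAt (fun t : ℝ => exp (-t)) (exp (-t) * -1) t := (hasDerivAt_neg t).exp
    have hs : HasDerivAt (fun t : ℝ => t - x) 1 t := (hasDerivAt_id t).sub_const x
    have h2 := (((hs.const_add 1).sub ((hs.pow 2).div_const 2)).div_const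
      (2 * (4 + x))).const_add (-(2 + x))
    refine (h1.mul h2).congr_deriv ?_
    simp
    field_simp
    ring
  have ht : Tendsto H atTop (nhds 0) := by
    have h0 := tendsto_pow_mul_exp_neg_atTop_nhds_zero 0
    have h1 := tendsto_pow_mul_exp_neg_atTop_nhds_zero 1
    have h2 := tendsto_pow_mul_exp_neg_atTop_nhds_zero 2
    have := ((h0.const_mul (-(2 + x) + (1 - x - x ^ 2 / 2) / (2 * (4 + x)))).add
      (h1.const_mul ((1 + x) / (2 * (4 + x))))).add (h2.const_mul (-1 / (4 * (4 + x))))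
    simp only [mul_zero, add_zero] at this
    refine this.congr fun t => ?_
    simp only [hH]
    field_simp
    ring
  rw [← ofReal_integral_eq_lintegral_ofReal
      (integrableOn_Ioi_deriv_of_nonneg' (fun t _ => hd t) hnn ht)
      ((ae_restrict_mem measurableSet_Ioi).mono hnn),
    integral_Ioi_of_hasDerivAt_of_nonneg' (fun t _ => hd t) hnn ht]
  congr 1
  simp only [hH]
  field_simp
  ring

lemma lintegral_Ioc_exp_neg {x : ℝ} (hx : 0 < x) :
    ∫⁻ t in Ioc 0 x, ENNReal.ofReal (exp (-t) * (2 + x)) =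
      ENNReal.ofReal ((1 - exp (-x)) * (2 + x)) := by
  have hc : Continuous fun t : ℝ => exp (-t) * (2 + x) := by fun_prop
  rw [← ofReal_integral_eq_lintegral_ofReal]
  · rw [← intervalIntegral.integral_of_le hx.le, intervalIntegral.integral_mul_const]
    simp [intervalIntegral.integral_comp_neg fun t => exp t]
  · exact (intervalIntegrable_iff_integrableOn_Ioc_of_le hx.le).1 (hc.intervalIntegrable _ _)
  · exact Eventually.of_forall fun t => mul_nonneg (exp_pos _).le (by linarith)

/-- The function `2 + y` on the half-line is a strict supersolution. -/
lemma lintegral_K_mul_affine_le {x : ℝ} (hx : 0 < x) :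
    ∫⁻ y in Ioi (0 : ℝ), ENNReal.ofReal (K (x - y)) * ENNReal.ofReal (2 + y) ≤
      ENNReal.ofReal (2 + x - exp (-x) / (2 * (4 + x))) := by
  have hlarge : ∀ t ∈ Ioi x,
      exp (-t) / (2 * t) * (2 * (x + t - 0) + ((x + t) ^ 2 - 0 ^ 2) / 2) ≤
        exp (-t) * (2 + x - (2 * (t - x) - (t - x) ^ 2 / 2) / (2 * (4 + x))) := by
    intro t ht
    have ht' : x < t := ht
    have ht0 : 0 < t := hx.trans ht
    rw [div_mul_eq_mul_div, mul_div_assoc]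
    refine mul_le_mul_of_nonneg_left ?_ (exp_pos _).le
    have : 2 + x - (2 * (t - x) - (t - x) ^ 2 / 2) / (2 * (4 + x)) -
        (2 * (x + t - 0) + ((x + t) ^ 2 - 0 ^ 2) / 2) / (2 * t) =
          (t - x) * (4 - (t - x)) ^ 2 / (4 * t * (4 + x)) := by
      field_simp
      ring
    have h2 : 0 ≤ (t - x) * (4 - (t - x)) ^ 2 / (4 * t * (4 + x)) :=
      div_nonneg (mul_nonneg (by linarith) (sq_nonneg _)) (by positivity)
    linarith
  have hnn : ∀ t ∈ Ioi x,
      0 ≤ exp (-t) * (2 + x - (2 * (t - x) - (t - x) ^ 2 / 2) / (2 * (4 + x))) := by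
    intro t ht
    have ht0 : 0 < t := hx.trans ht
    refine le_trans ?_ (hlarge t ht)
    simp only [sub_zero, ne_eq, OfNat.ofNat_ne_zero, not_false_eq_true, zero_pow]
    positivity
  have hmeas : Measurable fun p : ℝ × ℝ =>
      (if |x - p.1| < p.2 then ENNReal.ofReal (exp (-p.2) / (2 * p.2)) else 0) *
        ENNReal.ofReal (2 + p.1) := by
    refine Measurable.mul (Measurable.ite ?_ (by fun_prop) measurable_const) (by fun_prop)
    exact measurableSet_lt (by fun_prop) (by fun_prop)
  have hinner : ∀ t : ℝ,
      ∫⁻ y in Ioi (0 : ℝ), (if |x - y| < t then ENNReal.ofReal (exp (-t) / (2 * t)) else 0) *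
          ENNReal.ofReal (2 + y) ≤
        ENNReal.ofReal (exp (-t) / (2 * t)) * ∫⁻ y in Ioc (max 0 (x - t)) (x + t),
          ENNReal.ofReal (2 + y) := by
    intro t
    rw [← lintegral_const_mul _ (by fun_prop), ← lintegral_indicator measurableSet_Ioi,
      ← lintegral_indicator measurableSet_Ioc]
    refine lintegral_mono fun y => ?_
    by_cases hy : 0 < y
    · by_cases h : |x - y| < t
      · have h' := abs_lt.1 h
        have hm : y ∈ Ioc (max 0 (x - t)) (x + t) :=
          ⟨max_lt hy (by linarith [h'.2]), by linarith [h'.1]⟩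
        rw [indicator_of_mem hm, indicator_of_mem (mem_Ioi.2 hy), if_pos h]
      · simp [indicator_apply, h]
    · simp [hy]
  calc
    _ ≤ ∫⁻ y in Ioi (0 : ℝ), ∫⁻ t in Ioi (0 : ℝ),
        (if |x - y| < t then ENNReal.ofReal (exp (-t) / (2 * t)) else 0) *
          ENNReal.ofReal (2 + y) := by
      refine lintegral_mono fun y => ?_
      dsimp only
      rw [lintegral_mul_const']
      · gcongr
        exact ofReal_K_le _
      · exact ENNReal.ofReal_ne_top
    _ = ∫⁻ t in Ioi (0 : ℝ), ∫⁻ y in Ioi (0 : ℝ),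
        (if |x - y| < t then ENNReal.ofReal (exp (-t) / (2 * t)) else 0) *
          ENNReal.ofReal (2 + y) := lintegral_lintegral_swap hmeas.aemeasurable
    _ ≤ ∫⁻ t in Ioi (0 : ℝ), ENNReal.ofReal (exp (-t) / (2 * t)) *
        ∫⁻ y in Ioc (max 0 (x - t)) (x + t), ENNReal.ofReal (2 + y) := by
      refine setLIntegral_mono' measurableSet_Ioi fun t _ => hinner t
    _ = (∫⁻ t in Ioc 0 x, ENNReal.ofReal (exp (-t) / (2 * t)) *
          ∫⁻ y in Ioc (max 0 (x - t)) (x + t), ENNReal.ofReal (2 + y)) +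
        ∫⁻ t in Ioi x, ENNReal.ofReal (exp (-t) / (2 * t)) *
          ∫⁻ y in Ioc (max 0 (x - t)) (x + t), ENNReal.ofReal (2 + y) := by
      rw [← lintegral_union measurableSet_Ioi (Ioc_disjoint_Ioi le_rfl),
        Ioc_union_Ioi_eq_Ioi hx.le]
    _ ≤ (∫⁻ t in Ioc 0 x, ENNReal.ofReal (exp (-t) * (2 + x))) +
        ∫⁻ t in Ioi x, ENNReal.ofReal
          (exp (-t) * (2 + x - (2 * (t - x) - (t - x) ^ 2 / 2) / (2 * (4 + x)))) := by
      refine add_le_add (setLIntegral_mono' measurableSet_Ioc fun t ht => ?_)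
        (setLIntegral_mono' measurableSet_Ioi fun t ht => ?_)
      · have ht0 : 0 < t := ht.1
        have hxt : 0 ≤ x - t := sub_nonneg.2 ht.2
        rw [max_eq_right hxt, lintegral_Ioc_affine hxt (by linarith),
          ← ENNReal.ofReal_mul (by positivity)]
        refine (congrArg ENNReal.ofReal ?_).le
        field_simp
        ring
      · have ht0 : 0 < t := hx.trans ht
        have hxt : x - t ≤ 0 := sub_nonpos.2 (le_of_lt ht)
        rw [max_eq_left hxt, lintegral_Ioc_affine le_rfl (by linarith),
          ← ENNReal.ofReal_mul (by positivity)]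
        exact ENNReal.ofReal_le_ofReal (hlarge t ht)
    _ = _ := by
      have h1 : exp (-x) ≤ 1 := exp_le_one_iff.2 (by linarith)
      rw [lintegral_Ioc_exp_neg hx, lintegral_Ioi_majorant hx hnn,
        ← ENNReal.ofReal_add (mul_nonneg (by linarith) (by linarith))]
      · congr 1
        ring
      · have : exp (-x) / (2 * (4 + x)) ≤ exp (-x) * (2 + x) := by
          rw [div_le_iff₀ (by positivity), mul_assoc]
          exact le_mul_of_one_le_right (exp_pos _).le (by nlinarith)
        linarith

/-- A solution bounded by a multiple of the supersolution satisfies a strictly better bound. -/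
lemma abs_le_of_abs_le_affine {u : ℝ → ℝ}
    (heq : ∀ x > (0 : ℝ), u x = ∫ y : ℝ, K (x - y) * u y) (hneg : ∀ x < (0 : ℝ), u x = 0)
    {M : ℝ} (hM : 0 ≤ M) (hu : ∀ x > 0, |u x| ≤ M * (2 + x)) {x : ℝ} (hx : 0 < x) :
    |u x| ≤ M * (2 + x - exp (-x) / (2 * (4 + x))) := by
  have hpos : 0 ≤ 2 + x - exp (-x) / (2 * (4 + x)) := by
    have h1 : exp (-x) ≤ 1 := exp_le_one_iff.2 (by linarith)
    have : exp (-x) / (2 * (4 + x)) ≤ 1 := (div_le_one (by positivity)).2 (by linarith)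
    linarith
  rw [← ENNReal.ofReal_le_ofReal_iff (mul_nonneg hM hpos), ← Real.norm_eq_abs,
    ofReal_norm, heq x hx]
  calc
    _ ≤ ∫⁻ y, ‖K (x - y) * u y‖ₑ := enorm_integral_le_lintegral_enorm _
    _ ≤ ∫⁻ y, (Ioi (0 : ℝ)).indicator (fun y => ENNReal.ofReal M *
        (ENNReal.ofReal (K (x - y)) * ENNReal.ofReal (2 + y))) y := by
      refine lintegral_mono_ae ?_
      filter_upwards [Measure.ae_ne volume (0 : ℝ)] with y hy
      rcases hy.lt_or_gt with h | h
      · simp [hneg y h]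
      · rw [indicator_of_mem (mem_Ioi.2 h), ← ENNReal.ofReal_mul (K_nonneg _),
          ← ENNReal.ofReal_mul hM, ← ofReal_norm, norm_mul,
          Real.norm_of_nonneg (K_nonneg _), Real.norm_eq_abs, mul_left_comm]
        exact ENNReal.ofReal_le_ofReal (mul_le_mul_of_nonneg_left (hu y h) (K_nonneg _))
    _ = ENNReal.ofReal M * ∫⁻ y in Ioi (0 : ℝ),
        ENNReal.ofReal (K (x - y)) * ENNReal.ofReal (2 + y) := by
      rw [lintegral_indicator measurableSet_Ioi, lintegral_const_mul' _ _ ENNReal.ofReal_ne_top]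
    _ ≤ _ := by
      rw [ENNReal.ofReal_mul hM]
      gcongr
      exact lintegral_K_mul_affine_le hx

theorem homogeneous_trivial (u : ℝ → ℝ) (hmeas : Measurable u)
    (hbdd : ∃ C : ℝ, ∀ x, |u x| ≤ C)
    (heq : ∀ x > (0:ℝ), u x = ∫ y : ℝ, K (x - y) * u y)
    (hneg : ∀ x < (0:ℝ), u x = 0) :
    u =ᵐ[volume] 0 := by
  obtain ⟨C, hC⟩ := hbdd
  have hC0 : 0 ≤ C := (abs_nonneg _).trans (hC 0)
  set S : Set ℝ := {M | 0 ≤ M ∧ ∀ x > 0, |u x| ≤ M * (2 + x)} with hS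
  have hCS : C ∈ S := ⟨hC0, fun x hx => (hC x).trans (by nlinarith)⟩
  have hSb : BddBelow S := ⟨0, fun M hM => hM.1⟩
  have hSc : IsClosed S := by
    simp only [hS, ofPred_and, ofPred_forall]
    refine isClosed_Ici.inter (isClosed_iInter fun x => isClosed_iInter fun _ => ?_)
    exact isClosed_le continuous_const (by fun_prop)
  obtain ⟨m, hm⟩ : ∃ m, m = sInf S := ⟨_, rfl⟩
  have hmS : m ∈ S := hm ▸ hSc.csInf_mem ⟨C, hCS⟩ hSb
  have hmin : ∀ M ∈ S, m ≤ M := fun M hM => hm ▸ csInf_le hSb hM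
  have hm0 : m = 0 := by
    by_contra hne
    have hmpos : 0 < m := lt_of_le_of_ne hmS.1 (Ne.symm hne)
    set R : ℝ := 2 * C / m with hR
    have hR0 : 0 ≤ R := by positivity
    set q : ℝ := exp (-R) / (2 * (4 + R)) / (2 + R) with hq
    have hq0 : 0 < q := by positivity
    have hlt : max (1 / 2) (1 - q) < 1 := max_lt (by norm_num) (by linarith)
    have hle : 1 / 2 ≤ max (1 / 2) (1 - q) := le_max_left _ _
    have hmem : m * max (1 / 2) (1 - q) ∈ S := by
      refine ⟨mul_nonneg hmpos.le (by linarith), fun x hx => ?_⟩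
      rcases le_total x R with hxR | hxR
      · have hqx : q * (2 + x) ≤ exp (-x) / (2 * (4 + x)) := by
          calc
            q * (2 + x) ≤ q * (2 + R) := by gcongr
            _ = exp (-R) / (2 * (4 + R)) := div_mul_cancel₀ _ (by positivity)
            _ ≤ _ := by gcongr
        calc
          |u x| ≤ m * (2 + x - exp (-x) / (2 * (4 + x))) :=
            abs_le_of_abs_le_affine heq hneg hmpos.le hmS.2 hx
          _ ≤ m * ((1 - q) * (2 + x)) := by
            gcongr
            linarith
          _ ≤ m * (max (1 / 2) (1 - q) * (2 + x)) := by
            gcongr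
            exact le_max_right _ _
          _ = _ := by ring
      · calc
          |u x| ≤ C := hC x
          _ = m * (1 / 2 * R) := by
            rw [hR]
            field_simp
          _ ≤ m * (max (1 / 2) (1 - q) * (2 + x)) := by
            gcongr
            linarith
          _ = _ := by ring
    have := hmin _ hmem
    nlinarith
  filter_upwards [Measure.ae_ne volume (0 : ℝ)] with x hx
  rcases hx.lt_or_gt with h | h
  · exact hneg x h
  · have := hmS.2 x h
    rw [hm0, zero_mul] at this
    exact abs_nonpos_iff.1 this
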